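/- Let (X₀, X₁)_X be a pair of compatible metric spaces with X₀ ∩ X₁ ≠ ∅, let θ ∈ (0, 1) and q ∈ [1, ∞]. The functional δ_{θ,q}(x, y) := inf Σ_{j=0}^{n-1} P_{θ,q}(x_j, x_{j+1}), where the infimum is taken over all finite sequences x₀ = x, x₁, …, xₙ = y of points of X₀ ∩ X₁, is a metric on X₀ ∩ X₁. -/

import Mathlib

open scoped ENNReal Classical

/-- A function `d` is a metric on the subset `A` of `X`. -/
structure IsMetricOn {X : Type*} (d : X → X → ℝ) (A : Set X) : Prop where
  refl : ∀ x ∈ A, d x x = 0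
  eq_of_dist_eq_zero : ∀ x ∈ A, ∀ y ∈ A, d x y = 0 → x = y
  symm : ∀ x ∈ A, ∀ y ∈ A, d x y = d y x
  triangle : ∀ x ∈ A, ∀ y ∈ A, ∀ z ∈ A, d x z ≤ d x y + d y z

/-- A pair of compatible metric spaces `(X₀, X₁)_X` inside an ambient metric space `X`. -/
structure CompatiblePair (X : Type*) [MetricSpace X] where
  X0 : Set X
  X1 : Set X
  d0 : X → X → ℝ
  d1 : X → X → ℝ
  inter_nonempty : (X0 ∩ X1).Nonempty
  met0 : IsMetricOn d0 X0
  met1 : IsMetricOn d1 X1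
  C0 : ℝ
  C1 : ℝ
  C0_pos : 0 < C0
  C1_pos : 0 < C1
  compat0 : ∀ x ∈ X0, ∀ y ∈ X0, dist x y ≤ C0 * d0 x y
  compat1 : ∀ x ∈ X1, ∀ y ∈ X1, dist x y ≤ C1 * d1 x y

namespace CompatiblePair

variable {X : Type*} [MetricSpace X] (P : CompatiblePair X)

/-- The `J_M` functional: `J_M(t; x, y) = max {d₀(x,y), t·d₁(x,y)}`. -/
noncomputable def JM (t : ℝ) (x y : X) : ℝ := max (P.d0 x y) (t * P.d1 x y)

/-- The cost function `h_t` on pairs in `X₀² ∪ X₁²`. -/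
noncomputable def hFun (t : ℝ) (x y : X) : ℝ :=
  if x ∈ P.X0 ∩ P.X1 ∧ y ∈ P.X0 ∩ P.X1 then min (P.d0 x y) (t * P.d1 x y)
  else if x ∈ P.X0 ∧ y ∈ P.X0 then P.d0 x y
  else t * P.d1 x y

/-- `f 0 = x, …, f n = y` is an admissible linking sequence from `x` to `y` in `X₀ ∪ X₁`. -/
def IsAdmissibleChain (x y : X) (n : ℕ) (f : ℕ → X) : Prop :=
  f 0 = x ∧ f n = y ∧ (∀ k ≤ n, f k ∈ P.X0 ∪ P.X1) ∧
    ∀ k < n, (f k ∈ P.X0 ∧ f (k + 1) ∈ P.X0) ∨ (f k ∈ P.X1 ∧ f (k + 1) ∈ P.X1)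

/-- The `K_M` functional: infimum of `∑ h_t` over admissible linking sequences. -/
noncomputable def KM (t : ℝ) (x y : X) : ℝ :=
  sInf { s : ℝ | ∃ n f, P.IsAdmissibleChain x y n f ∧
    s = ∑ k ∈ Finset.range n, P.hFun t (f k) (f (k + 1)) }

end CompatiblePair

/-- The functional `Γ_{θ,q}` of a bi-infinite real sequence, valued in `[0,∞]`. -/
noncomputable def GammaE (θ : ℝ) (q : ℝ≥0∞) (x : ℤ → ℝ) : ℝ≥0∞ :=
  if q = ∞ then ⨆ k : ℤ, ENNReal.ofReal ((2 : ℝ) ^ (-(k : ℝ) * θ) * |x k|)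
  else (∑' k : ℤ, ENNReal.ofReal ((2 : ℝ) ^ (-(k : ℝ) * θ) * |x k|) ^ q.toReal) ^ (1 / q.toReal)

/-- The real-valued functional `Γ_{θ,q}`. -/
noncomputable def Gamma (θ : ℝ) (q : ℝ≥0∞) (x : ℤ → ℝ) : ℝ := (GammaE θ q x).toReal

/-- The constant `M_{θ,q} = Γ_{θ,q}((min{1, 2^k})_k)`. -/
noncomputable def MThetaQ (θ : ℝ) (q : ℝ≥0∞) : ℝ :=
  Gamma θ q (fun k : ℤ => min 1 ((2 : ℝ) ^ k))

/-- The constant `M'_{θ,q} = (∑_j (2^{jθ} min{1,2^{-j}})^p)^{1/p}` (with `p` the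
conjugate exponent of `q`, and the supremum modification for `p = ∞`). -/
noncomputable def MConst' (θ : ℝ) (p : ℝ≥0∞) : ℝ :=
  (if p = ∞ then ⨆ j : ℤ, ENNReal.ofReal ((2 : ℝ) ^ ((j : ℝ) * θ) * min 1 ((2 : ℝ) ^ (-(j : ℝ))))
   else (∑' j : ℤ,
      ENNReal.ofReal ((2 : ℝ) ^ ((j : ℝ) * θ) * min 1 ((2 : ℝ) ^ (-(j : ℝ)))) ^ p.toReal) ^
        (1 / p.toReal)).toReal

/-- The `ℓ^q` norm of a bi-infinite real sequence, valued in `[0,∞]`. -/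
noncomputable def lqNorm (q : ℝ≥0∞) (c : ℤ → ℝ) : ℝ≥0∞ :=
  if q = ∞ then ⨆ k : ℤ, ENNReal.ofReal |c k|
  else (∑' k : ℤ, ENNReal.ofReal |c k| ^ q.toReal) ^ (1 / q.toReal)

namespace CompatiblePair

variable {X : Type*} [MetricSpace X] (P : CompatiblePair X)

/-- The metric `β_{θ,q}(x,y) = Γ_{θ,q}((K_M(2^k; x, y))_k)` on `X₀ ∩ X₁`. -/
noncomputable def beta (θ : ℝ) (q : ℝ≥0∞) (x y : X) : ℝ :=
  Gamma θ q (fun k : ℤ => P.KM ((2 : ℝ) ^ k) x y)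

/-- `u` is an approximating sequence of `x` in `(X₀ ∩ X₁, J_M(1))`: a sequence in
`X₀ ∩ X₁`, Cauchy for `J_M(1)`, with `K_M(1; uₙ, x) → 0`. -/
def IsApproxSeq (x : X) (u : ℕ → X) : Prop :=
  (∀ n, u n ∈ P.X0 ∩ P.X1) ∧
  (∀ ε > 0, ∃ N, ∀ m ≥ N, ∀ n ≥ N, P.JM 1 (u m) (u n) < ε) ∧
  Filter.Tendsto (fun n => P.KM 1 (u n) x) Filter.atTop (nhds 0)

/-- The bi-infinite linking sequence `S_k = u_k` for `k ≥ 0`, `S_k = v_{-k}` for `k < 0`. -/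
noncomputable def linkSeq (u v : ℕ → X) : ℤ → X :=
  fun k => if 0 ≤ k then u k.toNat else v (-k).toNat

/-- The functional `p_{θ,q}` valued in `[0,∞]`: infimum of
`Γ_{θ,q}((J_M(2^k; S_k, S_{k+1}))_k)` over approximating sequences of `x` and `y`. -/
noncomputable def pFunE (θ : ℝ) (q : ℝ≥0∞) (x y : X) : ℝ≥0∞ :=
  ⨅ (u : ℕ → X) (v : ℕ → X) (_ : P.IsApproxSeq x u) (_ : P.IsApproxSeq y v),
    GammaE θ q (fun k : ℤ =>
      P.JM ((2 : ℝ) ^ k) (linkSeq u v k) (linkSeq u v (k + 1)))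

/-- The real-valued functional `p_{θ,q}`. -/
noncomputable def pFun (θ : ℝ) (q : ℝ≥0∞) (x y : X) : ℝ := (P.pFunE θ q x y).toReal

/-- The symmetrization `P_{θ,q}(x,y) = (p_{θ,q}(x,y) + p_{θ,q}(y,x))/2`. -/
noncomputable def PFun (θ : ℝ) (q : ℝ≥0∞) (x y : X) : ℝ :=
  (P.pFun θ q x y + P.pFun θ q y x) / 2

/-- The metric `δ_{θ,q}`: infimum of `∑ P_{θ,q}` over finite chains in `X₀ ∩ X₁`. -/
noncomputable def delta (θ : ℝ) (q : ℝ≥0∞) (x y : X) : ℝ :=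
  sInf { s : ℝ | ∃ (n : ℕ) (f : ℕ → X), f 0 = x ∧ f n = y ∧
    (∀ k ≤ n, f k ∈ P.X0 ∩ P.X1) ∧
    s = ∑ j ∈ Finset.range n, P.PFun θ q (f j) (f (j + 1)) }

end CompatiblePair

open Filter Topology

theorem IsMetricOn.nonneg {X : Type*} {d : X → X → ℝ} {A : Set X} (h : IsMetricOn d A)
    {x y : X} (hx : x ∈ A) (hy : y ∈ A) : 0 ≤ d x y := by
  have h1 := h.triangle x hx y hy x hx
  rw [h.refl x hx, h.symm y hy x hx] at h1
  linarith

/-- Every weighted term of the sequence is bounded by `Γ_{θ,q}`. -/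
theorem ofReal_le_GammaE (θ : ℝ) {q : ℝ≥0∞} (hq : 1 ≤ q) (a : ℤ → ℝ) (k : ℤ) :
    ENNReal.ofReal ((2 : ℝ) ^ (-(k : ℝ) * θ) * |a k|) ≤ GammaE θ q a := by
  unfold GammaE
  split_ifs with h
  · exact le_iSup (fun k : ℤ => ENNReal.ofReal ((2 : ℝ) ^ (-(k : ℝ) * θ) * |a k|)) k
  · have hpos : 0 < q.toReal := ENNReal.toReal_pos (by positivity) h
    rw [one_div, ENNReal.le_rpow_inv_iff hpos]
    exact ENNReal.le_tsum
      (f := fun k : ℤ => ENNReal.ofReal ((2 : ℝ) ^ (-(k : ℝ) * θ) * |a k|) ^ q.toReal) k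

theorem le_rpow_mul_toReal_GammaE (θ : ℝ) {q : ℝ≥0∞} (hq : 1 ≤ q) {a : ℤ → ℝ}
    (ha : GammaE θ q a ≠ ∞) (k : ℤ) :
    a k ≤ (2 : ℝ) ^ ((k : ℝ) * θ) * (GammaE θ q a).toReal := by
  have h := (ENNReal.ofReal_le_iff_le_toReal ha).1 (ofReal_le_GammaE θ hq a k)
  have hp : (0 : ℝ) < 2 ^ ((k : ℝ) * θ) := by positivity
  rw [neg_mul, Real.rpow_neg (by norm_num), inv_mul_le_iff₀ hp] at h
  exact (le_abs_self _).trans h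

/-- `Γ_{θ,q}` is finite on sequences with a single nonzero term. -/
theorem GammaE_ne_top_of_eq_zero (θ : ℝ) {q : ℝ≥0∞} (hq : 1 ≤ q) {a : ℤ → ℝ} (j : ℤ)
    (ha : ∀ k, k ≠ j → a k = 0) : GammaE θ q a ≠ ∞ := by
  unfold GammaE
  split_ifs with h
  · refine ne_top_of_le_ne_top
      (ENNReal.ofReal_ne_top (r := (2 : ℝ) ^ (-(j : ℝ) * θ) * |a j|)) (iSup_le fun k => ?_)
    by_cases hk : k = j
    · rw [hk]
    · simp [ha k hk]
  · have hpos : 0 < q.toReal := ENNReal.toReal_pos (by positivity) h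
    refine ENNReal.rpow_ne_top_of_nonneg (by positivity) ?_
    rw [tsum_eq_single j fun k hk => by simp [ha k hk, hpos]]
    exact ENNReal.rpow_ne_top_of_nonneg hpos.le ENNReal.ofReal_ne_top

namespace CompatiblePair

variable {X : Type*} [MetricSpace X] (P : CompatiblePair X)

theorem max_const_pos : 0 < max P.C0 P.C1 := lt_max_of_lt_left P.C0_pos

theorem dist_le_max_mul_d0 {x y : X} (hx : x ∈ P.X0) (hy : y ∈ P.X0) :
    dist x y ≤ max P.C0 P.C1 * P.d0 x y :=
  (P.compat0 x hx y hy).trans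
    (mul_le_mul_of_nonneg_right (le_max_left _ _) (P.met0.nonneg hx hy))

theorem dist_le_max_mul_d1 {x y : X} (hx : x ∈ P.X1) (hy : y ∈ P.X1) :
    dist x y ≤ max P.C0 P.C1 * P.d1 x y :=
  (P.compat1 x hx y hy).trans
    (mul_le_mul_of_nonneg_right (le_max_right _ _) (P.met1.nonneg hx hy))

theorem dist_le_hFun_one {x y : X}
    (h : (x ∈ P.X0 ∧ y ∈ P.X0) ∨ (x ∈ P.X1 ∧ y ∈ P.X1)) :
    dist x y ≤ max P.C0 P.C1 * P.hFun 1 x y := by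
  unfold hFun
  rw [one_mul]
  split_ifs with h1 h2
  · rcases min_choice (P.d0 x y) (P.d1 x y) with e | e <;> rw [e]
    · exact P.dist_le_max_mul_d0 h1.1.1 h1.2.1
    · exact P.dist_le_max_mul_d1 h1.1.2 h1.2.2
  · exact P.dist_le_max_mul_d0 h2.1 h2.2
  · have h3 := h.resolve_left h2
    exact P.dist_le_max_mul_d1 h3.1 h3.2

theorem dist_le_KM_one {x y : X} (hx : x ∈ P.X0 ∩ P.X1) (hy : y ∈ P.X0 ∩ P.X1) :
    dist x y ≤ max P.C0 P.C1 * P.KM 1 x y := by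
  rw [← div_le_iff₀' P.max_const_pos]
  refine le_csInf ⟨_, 1, fun k => if k = 0 then x else y, ⟨by simp, by simp, ?_, ?_⟩, rfl⟩ ?_
  · intro k _
    dsimp only
    split_ifs
    exacts [Or.inl hx.1, Or.inl hy.1]
  · intro k hk
    obtain rfl : k = 0 := by omega
    exact Or.inl ⟨by simpa using hx.1, by simpa using hy.1⟩
  · rintro s ⟨n, f, ⟨h0, hn, -, hf⟩, rfl⟩
    rw [div_le_iff₀' P.max_const_pos, Finset.mul_sum, ← h0, ← hn]
    refine (dist_le_range_sum_dist f n).trans (Finset.sum_le_sum fun k hk => ?_)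
    exact P.dist_le_hFun_one (hf k (Finset.mem_range.1 hk))

theorem IsApproxSeq.tendsto {P : CompatiblePair X} {x : X} {u : ℕ → X}
    (h : P.IsApproxSeq x u) (hx : x ∈ P.X0 ∩ P.X1) : Tendsto u atTop (𝓝 x) := by
  rw [tendsto_iff_dist_tendsto_zero]
  refine squeeze_zero (fun _ => dist_nonneg) (fun n => P.dist_le_KM_one (h.1 n) hx) ?_
  simpa using h.2.2.const_mul (max P.C0 P.C1)

theorem JM_self (t : ℝ) {x : X} (hx : x ∈ P.X0 ∩ P.X1) : P.JM t x x = 0 := by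
  simp [JM, P.met0.refl x hx.1, P.met1.refl x hx.2]

theorem KM_self (t : ℝ) (ht : 0 ≤ t) {x : X} (hx : x ∈ P.X0 ∩ P.X1) : P.KM t x x = 0 := by
  have hnn : ∀ s ∈ { s : ℝ | ∃ n f, P.IsAdmissibleChain x x n f ∧
      s = ∑ k ∈ Finset.range n, P.hFun t (f k) (f (k + 1)) }, 0 ≤ s := by
    rintro s ⟨n, f, ⟨-, -, -, hf⟩, rfl⟩
    refine Finset.sum_nonneg fun k hk => ?_
    have h := hf k (Finset.mem_range.1 hk)
    unfold hFun
    split_ifs with h1 h2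
    · exact le_min (P.met0.nonneg h1.1.1 h1.2.1)
        (mul_nonneg ht (P.met1.nonneg h1.1.2 h1.2.2))
    · exact P.met0.nonneg h2.1 h2.2
    · have h3 := h.resolve_left h2
      exact mul_nonneg ht (P.met1.nonneg h3.1 h3.2)
  refine le_antisymm (csInf_le ⟨0, hnn⟩ ⟨0, fun _ => x, ⟨rfl, rfl, ?_, ?_⟩, by simp⟩)
    (Real.sInf_nonneg hnn)
  · exact fun _ _ => Or.inl hx.1
  · intro k hk
    omega

theorem isApproxSeq_const {x : X} (hx : x ∈ P.X0 ∩ P.X1) :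
    P.IsApproxSeq x fun _ => x := by
  refine ⟨fun _ => hx, fun ε hε => ⟨0, fun _ _ _ _ => ?_⟩, ?_⟩
  · rwa [P.JM_self 1 hx]
  · simp [P.KM_self 1 zero_le_one hx]

theorem pFunE_ne_top (θ : ℝ) {q : ℝ≥0∞} (hq : 1 ≤ q) {x y : X}
    (hx : x ∈ P.X0 ∩ P.X1) (hy : y ∈ P.X0 ∩ P.X1) : P.pFunE θ q x y ≠ ∞ := by
  refine ne_top_of_le_ne_top ?_ (iInf₂_le_of_le (fun _ => x) (fun _ => y)
    (iInf₂_le (P.isApproxSeq_const hx) (P.isApproxSeq_const hy)))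
  refine GammaE_ne_top_of_eq_zero θ hq (-1) fun k hk => ?_
  unfold linkSeq
  by_cases h : 0 ≤ k
  · rw [if_pos h, if_pos (by omega), P.JM_self _ hx]
  · rw [if_neg h, if_neg (by omega), P.JM_self _ hy]

/-- The sum of the two geometric series controlling the ambient distance by `p_{θ,q}`. -/
noncomputable def embConst (θ : ℝ) : ℝ :=
  max P.C0 P.C1 * (1 / (1 - (2 : ℝ) ^ (θ - 1)) + 1 / (1 - (2 : ℝ) ^ (-θ)))

theorem embConst_pos {θ : ℝ} (hθ : θ ∈ Set.Ioo (0 : ℝ) 1) : 0 < P.embConst θ := by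
  have h1 : (2 : ℝ) ^ (θ - 1) < 1 :=
    Real.rpow_lt_one_of_one_lt_of_neg (by norm_num) (by linarith [hθ.2])
  have h2 : (2 : ℝ) ^ (-θ) < 1 :=
    Real.rpow_lt_one_of_one_lt_of_neg (by norm_num) (by linarith [hθ.1])
  have h3 := one_div_pos.2 (sub_pos.2 h1)
  have h4 := one_div_pos.2 (sub_pos.2 h2)
  exact mul_pos P.max_const_pos (add_pos h3 h4)

theorem dist_le_embConst_mul_GammaE {θ : ℝ} (hθ : θ ∈ Set.Ioo (0 : ℝ) 1) {q : ℝ≥0∞}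
    (hq : 1 ≤ q) {x y : X} (hx : x ∈ P.X0 ∩ P.X1) (hy : y ∈ P.X0 ∩ P.X1) {u v : ℕ → X}
    (hu : P.IsApproxSeq x u) (hv : P.IsApproxSeq y v)
    (hfin : GammaE θ q (fun k : ℤ =>
      P.JM ((2 : ℝ) ^ k) (linkSeq u v k) (linkSeq u v (k + 1))) ≠ ∞) :
    dist x y ≤ P.embConst θ * (GammaE θ q (fun k : ℤ =>
      P.JM ((2 : ℝ) ^ k) (linkSeq u v k) (linkSeq u v (k + 1)))).toReal := by
  have hJ := le_rpow_mul_toReal_GammaE θ hq hfin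
  set G := (GammaE θ q (fun k : ℤ =>
      P.JM ((2 : ℝ) ^ k) (linkSeq u v k) (linkSeq u v (k + 1)))).toReal
  have hG : 0 ≤ G := ENNReal.toReal_nonneg
  have hC := P.max_const_pos
  have hpos (n : ℕ) : linkSeq u v n = u n := by simp [linkSeq]
  have hneg (n : ℕ) : linkSeq u v (-((n + 1 : ℕ) : ℤ)) = v (n + 1) := by
    unfold linkSeq
    rw [if_neg (by omega)]
    congr 1
  have hmem (k : ℤ) : linkSeq u v k ∈ P.X0 ∩ P.X1 := by
    unfold linkSeq
    split_ifs
    exacts [hu.1 _, hv.1 _]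
  have hux : dist (u 0) x ≤ max P.C0 P.C1 * G / (1 - (2 : ℝ) ^ (θ - 1)) := by
    refine dist_le_of_le_geometric_of_tendsto₀ _ _
      (Real.rpow_lt_one_of_one_lt_of_neg (by norm_num) (by linarith [hθ.2])) (fun n => ?_)
      (hu.tendsto hx)
    have h := (le_max_right _ _).trans (hJ n)
    have hS := hpos (n + 1)
    push_cast at hS
    rw [hpos, hS, zpow_natCast, Int.cast_natCast] at h
    refine (P.dist_le_max_mul_d1 (hu.1 n).2 (hu.1 (n + 1)).2).trans ?_
    rw [mul_assoc]
    refine mul_le_mul_of_nonneg_left ?_ hC.le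
    have h2 : (2 : ℝ) ^ ((n : ℝ) * θ) = 2 ^ n * ((2 : ℝ) ^ (θ - 1)) ^ n := by
      rw [← Real.rpow_natCast, ← Real.rpow_natCast, ← Real.rpow_mul (by norm_num),
        ← Real.rpow_add (by norm_num)]
      congr 1
      ring
    rw [h2, mul_assoc, mul_comm _ G] at h
    exact le_of_mul_le_mul_left h (by positivity)
  have hvy : dist (u 0) y ≤ max P.C0 P.C1 * G / (1 - (2 : ℝ) ^ (-θ)) := by
    have hw : Tendsto (fun n : ℕ => linkSeq u v (-(n : ℤ))) atTop (𝓝 y) := by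
      rw [← tendsto_add_atTop_iff_nat 1]
      simp only [hneg]
      exact (tendsto_add_atTop_iff_nat 1).2 (hv.tendsto hy)
    have hdist := dist_le_of_le_geometric_of_tendsto₀ ((2 : ℝ) ^ (-θ)) (max P.C0 P.C1 * G)
      (Real.rpow_lt_one_of_one_lt_of_neg (by norm_num) (by linarith [hθ.1])) (fun n => ?_) hw
    · simpa [linkSeq] using hdist
    have h := (le_max_left _ _).trans (hJ (-((n + 1 : ℕ) : ℤ)))
    rw [show -((n + 1 : ℕ) : ℤ) + 1 = -(n : ℤ) by push_cast; ring] at h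
    rw [dist_comm]
    refine (P.dist_le_max_mul_d0 (hmem _).1 (hmem _).1).trans ?_
    rw [mul_assoc, mul_comm G]
    refine mul_le_mul_of_nonneg_left (h.trans ?_) hC.le
    refine mul_le_mul_of_nonneg_right ?_ hG
    rw [← Real.rpow_natCast, ← Real.rpow_mul (by norm_num)]
    refine Real.rpow_le_rpow_of_exponent_le (by norm_num) ?_
    push_cast
    linarith [hθ.1]
  have := dist_triangle_left x y (u 0)
  calc dist x y ≤ _ := this
    _ ≤ _ := add_le_add hux hvy
    _ = _ := by unfold embConst; ring

theorem dist_le_embConst_mul_pFun {θ : ℝ} (hθ : θ ∈ Set.Ioo (0 : ℝ) 1) {q : ℝ≥0∞}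
    (hq : 1 ≤ q) {x y : X} (hx : x ∈ P.X0 ∩ P.X1) (hy : y ∈ P.X0 ∩ P.X1) :
    dist x y ≤ P.embConst θ * P.pFun θ q x y := by
  rw [← div_le_iff₀' (P.embConst_pos hθ), pFun,
    ← ENNReal.ofReal_le_iff_le_toReal (P.pFunE_ne_top θ hq hx hy)]
  refine le_iInf₂ fun u v => le_iInf₂ fun hu hv => ?_
  by_cases hfin : GammaE θ q (fun k : ℤ =>
      P.JM ((2 : ℝ) ^ k) (linkSeq u v k) (linkSeq u v (k + 1))) = ∞
  · exact hfin ▸ le_top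
  · rw [ENNReal.ofReal_le_iff_le_toReal hfin, div_le_iff₀' (P.embConst_pos hθ)]
    exact P.dist_le_embConst_mul_GammaE hθ hq hx hy hu hv hfin

theorem dist_le_embConst_mul_PFun {θ : ℝ} (hθ : θ ∈ Set.Ioo (0 : ℝ) 1) {q : ℝ≥0∞}
    (hq : 1 ≤ q) {x y : X} (hx : x ∈ P.X0 ∩ P.X1) (hy : y ∈ P.X0 ∩ P.X1) :
    dist x y ≤ P.embConst θ * P.PFun θ q x y := by
  have h1 := P.dist_le_embConst_mul_pFun hθ hq hx hy
  have h2 := P.dist_le_embConst_mul_pFun hθ hq hy hx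
  rw [dist_comm] at h2
  unfold PFun
  linarith

theorem PFun_nonneg (θ : ℝ) (q : ℝ≥0∞) (x y : X) : 0 ≤ P.PFun θ q x y :=
  div_nonneg (add_nonneg ENNReal.toReal_nonneg ENNReal.toReal_nonneg) zero_le_two

theorem PFun_comm (θ : ℝ) (q : ℝ≥0∞) (x y : X) : P.PFun θ q x y = P.PFun θ q y x := by
  unfold PFun
  rw [add_comm]

/-- The lengths of finite chains from `x` to `y` in `X₀ ∩ X₁`. -/
def deltaSet (θ : ℝ) (q : ℝ≥0∞) (x y : X) : Set ℝ :=
  { s : ℝ | ∃ (n : ℕ) (f : ℕ → X), f 0 = x ∧ f n = y ∧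
    (∀ k ≤ n, f k ∈ P.X0 ∩ P.X1) ∧
    s = ∑ j ∈ Finset.range n, P.PFun θ q (f j) (f (j + 1)) }

theorem delta_eq_sInf (θ : ℝ) (q : ℝ≥0∞) (x y : X) :
    P.delta θ q x y = sInf (P.deltaSet θ q x y) := rfl

theorem bddBelow_deltaSet (θ : ℝ) (q : ℝ≥0∞) (x y : X) :
    BddBelow (P.deltaSet θ q x y) := by
  refine ⟨0, ?_⟩
  rintro s ⟨n, f, -, -, -, rfl⟩
  exact Finset.sum_nonneg fun _ _ => P.PFun_nonneg θ q _ _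

theorem deltaSet_nonempty (θ : ℝ) (q : ℝ≥0∞) {x y : X} (hx : x ∈ P.X0 ∩ P.X1)
    (hy : y ∈ P.X0 ∩ P.X1) : (P.deltaSet θ q x y).Nonempty := by
  refine ⟨_, 1, fun k => if k = 0 then x else y, by simp, by simp, fun k _ => ?_, rfl⟩
  dsimp only
  split_ifs
  exacts [hx, hy]

theorem deltaSet_subset_swap (θ : ℝ) (q : ℝ≥0∞) (x y : X) :
    P.deltaSet θ q x y ⊆ P.deltaSet θ q y x := by
  rintro s ⟨n, f, h0, hn, hf, rfl⟩
  refine ⟨n, fun k => f (n - k), by simpa using hn, by simpa using h0,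
    fun k _ => hf _ (Nat.sub_le n k), ?_⟩
  rw [← Finset.sum_range_reflect]
  refine Finset.sum_congr rfl fun j hj => ?_
  have hj := Finset.mem_range.1 hj
  rw [P.PFun_comm]
  congr 2 <;> omega

theorem add_mem_deltaSet {θ : ℝ} {q : ℝ≥0∞} {x y z : X} {s t : ℝ}
    (hs : s ∈ P.deltaSet θ q x y) (ht : t ∈ P.deltaSet θ q y z) :
    s + t ∈ P.deltaSet θ q x z := by
  obtain ⟨n, f, f0, fn, hf, rfl⟩ := hs
  obtain ⟨m, g, g0, gm, hg, rfl⟩ := ht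
  have hright (j : ℕ) : (if n + j ≤ n then f (n + j) else g (n + j - n)) = g j := by
    split_ifs with h
    · obtain rfl : j = 0 := by omega
      rw [add_zero, fn, g0]
    · rw [Nat.add_sub_cancel_left]
  refine ⟨n + m, fun k => if k ≤ n then f k else g (k - n), by simpa using f0, ?_, ?_, ?_⟩
  · exact (hright m).trans gm
  · intro k hk
    dsimp only
    split_ifs with h
    exacts [hf k h, hg _ (by omega)]
  · rw [Finset.sum_range_add]
    congr 1
    · refine Finset.sum_congr rfl fun j hj => ?_
      have hj := Finset.mem_range.1 hj
      dsimp only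
      rw [if_pos (by omega), if_pos (by omega)]
    · refine Finset.sum_congr rfl fun j _ => ?_
      dsimp only
      rw [hright j, add_assoc, hright (j + 1)]

theorem dist_le_embConst_mul_delta {θ : ℝ} (hθ : θ ∈ Set.Ioo (0 : ℝ) 1) {q : ℝ≥0∞}
    (hq : 1 ≤ q) {x y : X} (hx : x ∈ P.X0 ∩ P.X1) (hy : y ∈ P.X0 ∩ P.X1) :
    dist x y ≤ P.embConst θ * P.delta θ q x y := by
  rw [← div_le_iff₀' (P.embConst_pos hθ), delta_eq_sInf]
  refine le_csInf (P.deltaSet_nonempty θ q hx hy) ?_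
  rintro s ⟨n, f, rfl, rfl, hf, rfl⟩
  rw [div_le_iff₀' (P.embConst_pos hθ), Finset.mul_sum]
  refine (dist_le_range_sum_dist f n).trans (Finset.sum_le_sum fun k hk => ?_)
  have hk := Finset.mem_range.1 hk
  exact P.dist_le_embConst_mul_PFun hθ hq (hf k hk.le) (hf (k + 1) hk)

end CompatiblePair

/-- `δ_{θ,q}` is a metric on `X₀ ∩ X₁`. -/
theorem delta_isMetricOn {X : Type*} [MetricSpace X] (P : CompatiblePair X)
    (θ : ℝ) (hθ : θ ∈ Set.Ioo (0 : ℝ) 1) (q : ℝ≥0∞) (hq : 1 ≤ q) :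
    IsMetricOn (P.delta θ q) (P.X0 ∩ P.X1) := by
  refine ⟨fun x hx => ?_, fun x hx y hy h => ?_, fun x _ y _ => ?_, fun x hx y hy z hz => ?_⟩
  · refine le_antisymm (csInf_le (P.bddBelow_deltaSet θ q x x)
      ⟨0, fun _ => x, rfl, rfl, fun _ _ => hx, by simp⟩) (Real.sInf_nonneg ?_)
    rintro s ⟨n, f, -, -, -, rfl⟩
    exact Finset.sum_nonneg fun _ _ => P.PFun_nonneg θ q _ _
  · have hd := P.dist_le_embConst_mul_delta hθ hq hx hy
    rw [h, mul_zero] at hd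
    exact dist_le_zero.1 hd
  · rw [P.delta_eq_sInf, P.delta_eq_sInf,
      (P.deltaSet_subset_swap θ q x y).antisymm (P.deltaSet_subset_swap θ q y x)]
  · rw [P.delta_eq_sInf θ q x y, P.delta_eq_sInf θ q y z, ← sub_le_iff_le_add]
    refine le_csInf (P.deltaSet_nonempty θ q hx hy) fun s hs => ?_
    rw [sub_le_comm]
    refine le_csInf (P.deltaSet_nonempty θ q hy hz) fun t ht => ?_
    rw [sub_le_iff_le_add']
    exact csInf_le (P.bddBelow_deltaSet θ q x z) (P.add_mem_deltaSet hs ht)
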